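/- There exist a constant c > 0 and an n_0 such that for all n ≥ n_0, C_3(n, SP_3) ≥ c · (log n / log log n)^{1/8}. Concretely, for every k > 0, if n ≥ 2k^{(k^4+1)^2} + k^4 + 3, then no family of n edge-colorings of K_n^{(3)} with k colors is an (n,3,SP_3)-local coloring, so C_3(n,SP_3) > k. -/

import Mathlib

open Finset

/-- A hypergraph on a finite set of natural-number vertices. -/
structure HGraph where
  verts : Finset ℕ
  edges : Finset (Finset ℕ)

/-- `H` is an `r`-uniform hypergraph. -/
def HGraph.IsUniform (H : HGraph) (r : ℕ) : Prop :=
  ∀ e ∈ H.edges, e ⊆ H.verts ∧ e.card = r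

/-- `φ` determines a copy of `H` in the complete hypergraph on vertex set `range n`. -/
def IsCopy (n : ℕ) (H : HGraph) (φ : ℕ → ℕ) : Prop :=
  Set.InjOn φ ↑H.verts ∧ ∀ v ∈ H.verts, φ v ∈ Finset.range n

/-- The family of edge-colourings `f v` with `k` colours is an `(n,r,H)`-local colouring:
for every copy of `H` there is a vertex of the copy whose colouring is rainbow on it. -/
def IsLocalColoring (n k : ℕ) (H : HGraph) (f : ℕ → Finset ℕ → Fin k) : Prop :=
  ∀ φ : ℕ → ℕ, IsCopy n H φ →
    ∃ x ∈ H.verts, ∀ e₁ ∈ H.edges, ∀ e₂ ∈ H.edges,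
      f (φ x) (e₁.image φ) = f (φ x) (e₂.image φ) → e₁ = e₂

/-- The local rainbow colouring number `C_r(n,H)`:
the least number of colours admitting an `(n,r,H)`-local colouring. -/
noncomputable def localC (n : ℕ) (H : HGraph) : ℕ :=
  sInf {k | ∃ f : ℕ → Finset ℕ → Fin k, IsLocalColoring n k H f}

/-- The tight path `TP₃` (vertices `a,b,c,d,e = 0,1,2,3,4`). -/
def TP3 : HGraph := ⟨{0, 1, 2, 3, 4}, {{0, 1, 2}, {1, 2, 3}, {2, 3, 4}}⟩

/-- The special path `SP₃` (vertices `a,b,c,d,e,f = 0,1,2,3,4,5`). -/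
def SP3 : HGraph := ⟨{0, 1, 2, 3, 4, 5}, {{0, 1, 2}, {1, 2, 3}, {3, 4, 5}}⟩

/-- The loose cycle `LC₃` (vertices `a,b,c,d,e,f = 0,1,2,3,4,5`). -/
def LC3 : HGraph := ⟨{0, 1, 2, 3, 4, 5}, {{0, 1, 3}, {1, 2, 4}, {0, 2, 5}}⟩

/-- A local colouring can be regarded as one with more colours. -/
theorem IsLocalColoring.castLE {n k l : ℕ} {H : HGraph} (hkl : k ≤ l)
    {f : ℕ → Finset ℕ → Fin k} (hf : IsLocalColoring n k H f) :
    IsLocalColoring n l H fun v e => Fin.castLE hkl (f v e) := by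
  intro φ hφ
  obtain ⟨x, hx, h⟩ := hf φ hφ
  exact ⟨x, hx, fun e₁ h₁ e₂ h₂ he => h e₁ h₁ e₂ h₂ (Fin.castLE_injective hkl he)⟩

/-- Giving distinct colours to all edges is a local colouring. -/
theorem exists_isLocalColoring {n r : ℕ} {H : HGraph} (hne : H.verts.Nonempty)
    (hH : H.IsUniform r) : ∃ k, ∃ f : ℕ → Finset ℕ → Fin k, IsLocalColoring n k H f := by
  classical
  let g := (range n).powerset.equivFin
  have h0 : 0 < (range n).powerset.card := card_pos.2 ⟨∅, by simp⟩
  refine ⟨(range n).powerset.card,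
    fun _ e => if he : e ∈ (range n).powerset then g ⟨e, he⟩ else ⟨0, h0⟩, ?_⟩
  intro φ hφ
  obtain ⟨x, hx⟩ := hne
  have hmem : ∀ e ∈ H.edges, e.image φ ∈ (range n).powerset := by
    intro e he
    rw [mem_powerset, image_subset_iff]
    exact fun v hv => hφ.2 v ((hH e he).1 hv)
  refine ⟨x, hx, fun e₁ h₁ e₂ h₂ he => ?_⟩
  simp only [dif_pos (hmem e₁ h₁), dif_pos (hmem e₂ h₂)] at he
  have himg : e₁.image φ = e₂.image φ := congrArg Subtype.val (g.injective he)
  have hs : φ '' (e₁ : Set ℕ) = φ '' (e₂ : Set ℕ) := by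
    rw [← coe_image, ← coe_image, himg]
  exact_mod_cast (hφ.1.image_eq_image_iff (coe_subset.2 (hH e₁ h₁).1)
    (coe_subset.2 (hH e₂ h₂).1)).1 hs

theorem SP3_isUniform : SP3.IsUniform 3 := by
  unfold HGraph.IsUniform SP3
  decide

/-- If no local colouring with `k` colours exists, then `localC` exceeds `k`. -/
theorem lt_localC {n k r : ℕ} {H : HGraph} (hne : H.verts.Nonempty) (hH : H.IsUniform r)
    (h : ∀ f : ℕ → Finset ℕ → Fin k, ¬ IsLocalColoring n k H f) : k < localC n H := by
  by_contra! hle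
  obtain ⟨f, hf⟩ : ∃ f : ℕ → Finset ℕ → Fin (localC n H), IsLocalColoring n (localC n H) H f :=
    Nat.sInf_mem (exists_isLocalColoring hne hH)
  exact h _ (hf.castLE hle)

/-- Six distinct vertices spanning a copy of `SP3` on which no vertex sees a rainbow
obstruct local colourings. -/
theorem not_isLocalColoring_SP3_of_vertices {n k : ℕ} {f : ℕ → Finset ℕ → Fin k}
    {a b c d u v : ℕ} (hnd : [a, b, c, d, u, v].Nodup) (hn : ∀ x ∈ [a, b, c, d, u, v], x < n)
    (ha : f a {b, c, d} = f a {d, u, v}) (hd : f d {b, c, d} = f d {d, u, v})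
    (hb : f b {a, b, c} = f b {b, c, d}) (hc : f c {a, b, c} = f c {b, c, d})
    (hu : f u {a, b, c} = f u {b, c, d}) (hv : f v {a, b, c} = f v {b, c, d}) :
    ¬ IsLocalColoring n k SP3 f := by
  intro h
  let φ : ℕ → ℕ := fun i => [a, b, c, d, u, v].getD i 0
  have hφ : IsCopy n SP3 φ := by
    constructor
    · intro i hi j hj hij
      have hi' : i < 6 := by simp [SP3] at hi; omega
      have hj' : j < 6 := by simp [SP3] at hj; omega
      have hi'' : i < [a, b, c, d, u, v].length := hi'
      have hj'' : j < [a, b, c, d, u, v].length := hj'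
      refine (hnd.getElem_inj_iff (hi := hi'') (hj := hj'')).1 ?_
      simpa only [φ, List.getD_eq_getElem _ _ hi'', List.getD_eq_getElem _ _ hj''] using hij
    · intro i hi
      have hi' : i < [a, b, c, d, u, v].length := by simp [SP3] at hi ⊢; omega
      simp only [φ, List.getD_eq_getElem _ _ hi', mem_range]
      exact hn _ (List.getElem_mem _)
  have e₁ : ({0, 1, 2} : Finset ℕ).image φ = {a, b, c} := by simp [φ, image_insert]
  have e₂ : ({1, 2, 3} : Finset ℕ).image φ = {b, c, d} := by simp [φ, image_insert]
  have e₃ : ({3, 4, 5} : Finset ℕ).image φ = {d, u, v} := by simp [φ, image_insert]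
  have n₁₂ : ({0, 1, 2} : Finset ℕ) ≠ {1, 2, 3} := by decide
  have n₂₃ : ({1, 2, 3} : Finset ℕ) ≠ {3, 4, 5} := by decide
  obtain ⟨x, hx, hr⟩ := h φ hφ
  have r₁₂ := hr {0, 1, 2} (by simp [SP3]) {1, 2, 3} (by simp [SP3])
  have r₂₃ := hr {1, 2, 3} (by simp [SP3]) {3, 4, 5} (by simp [SP3])
  rw [e₁, e₂] at r₁₂
  rw [e₂, e₃] at r₂₃
  simp only [SP3, mem_insert, mem_singleton] at hx
  rcases hx with rfl | rfl | rfl | rfl | rfl | rfl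
  · exact n₂₃ (r₂₃ ha)
  · exact n₁₂ (r₁₂ hb)
  · exact n₁₂ (r₁₂ hc)
  · exact n₂₃ (r₂₃ hd)
  · exact n₁₂ (r₁₂ hu)
  · exact n₁₂ (r₁₂ hv)

theorem not_isLocalColoring_SP3 {n k : ℕ} (hn : 2 * k ^ ((k ^ 4 + 1) ^ 2) + k ^ 4 + 3 ≤ n)
    (f : ℕ → Finset ℕ → Fin k) : ¬ IsLocalColoring n k SP3 f := by
  set N := k ^ 4 + 1 with hN
  -- Two disjoint pairs of vertices seen alike by all of `0, …, N - 1`.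
  let P : Fin (k ^ (N ^ 2) + 1) → Fin N → Fin N → Fin k :=
    fun t i j => f i {N + 2 * t, N + 2 * t + 1, (j : ℕ)}
  obtain ⟨s, t, hst, hP⟩ := Fintype.exists_ne_map_eq_of_card_lt P (by
    simp [← pow_mul, sq])
  -- Two of `0, …, N - 1` completing the first pair to edges that these pairs see alike.
  let Q : Fin N → Fin k × Fin k × Fin k × Fin k := fun i =>
    let e : Finset ℕ := {(i : ℕ), N + 2 * s, N + 2 * s + 1}
    (f (N + 2 * s) e, f (N + 2 * s + 1) e, f (N + 2 * t) e, f (N + 2 * t + 1) e)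
  obtain ⟨i, j, hij, hQ⟩ := Fintype.exists_ne_map_eq_of_card_lt Q (by
    simp only [Fintype.card_prod, Fintype.card_fin, hN]
    exact Nat.lt_succ_of_le (le_of_eq (by ring)))
  have rot : ∀ x y z : ℕ, ({x, y, z} : Finset ℕ) = {y, z, x} := by
    intro x y z
    ext w
    simp only [mem_insert, mem_singleton]
    tauto
  have hPi := congrFun₂ hP i j
  have hPj := congrFun₂ hP j j
  simp only [Q, Prod.mk.injEq] at hQ
  simp only [P] at hPi hPj
  have hst' : (s : ℕ) ≠ t := fun h => hst (Fin.ext h)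
  have hij' : (i : ℕ) ≠ j := fun h => hij (Fin.ext h)
  have hs := s.isLt
  have ht := t.isLt
  have hi := i.isLt
  have hj := j.isLt
  rw [rot (j : ℕ)] at hQ
  refine not_isLocalColoring_SP3_of_vertices (a := i) (b := N + 2 * s) (c := N + 2 * s + 1)
    (d := j) (u := N + 2 * t) (v := N + 2 * t + 1) ?_ ?_ ?_ ?_ hQ.1 hQ.2.1 hQ.2.2.1 hQ.2.2.2
  · simp only [List.nodup_cons, List.mem_cons, List.not_mem_nil, List.nodup_nil,
      or_false, not_false_eq_true, and_true]
    omega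
  · intro x hx
    simp only [List.mem_cons, List.not_mem_nil, or_false] at hx
    omega
  · rw [hPi, rot (j : ℕ)]
  · rw [hPj, rot (j : ℕ)]

theorem two_mul_pow_add_le_pow {m : ℕ} (hm : 2 ≤ m) :
    2 * m ^ ((m ^ 4 + 1) ^ 2) + m ^ 4 + 3 ≤ m ^ (8 * m ^ 8) := by
  have hq : 2 ^ 4 ≤ m ^ 4 := Nat.pow_le_pow_left hm 4
  have h₁ : m ^ 5 ≤ m ^ ((m ^ 4 + 1) ^ 2) := Nat.pow_le_pow_right (by omega) (by nlinarith)
  have h₂ : m ^ 4 + 3 ≤ m ^ 5 := by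
    rw [pow_succ m 4]
    nlinarith
  have h₃ : m ^ ((m ^ 4 + 1) ^ 2 + 2) ≤ m ^ (8 * m ^ 8) := by
    refine Nat.pow_le_pow_right (by omega) ?_
    have : m ^ 8 = m ^ 4 * m ^ 4 := by ring
    nlinarith
  rw [pow_add] at h₃
  have h₄ : 2 ^ 2 ≤ m ^ 2 := Nat.pow_le_pow_left hm 2
  nlinarith [Nat.mul_le_mul_left (m ^ ((m ^ 4 + 1) ^ 2)) h₄]

theorem log_div_log_log_rpow_le {n m : ℕ} (hn : Real.exp (Real.exp 1) ≤ n) (hm : 2 ≤ m)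
    (h : n < m ^ (8 * m ^ 8)) :
    (Real.log n / Real.log (Real.log n)) ^ ((1 : ℝ) / 8) ≤ 8 * m := by
  have hn0 : (0 : ℝ) < n := (Real.exp_pos _).trans_le hn
  have hL : Real.exp 1 ≤ Real.log n := (Real.le_log_iff_exp_le hn0).2 hn
  have hL0 : 0 < Real.log n := (Real.exp_pos _).trans_le hL
  have hLL : 1 ≤ Real.log (Real.log n) := (Real.le_log_iff_exp_le hL0).2 hL
  have hm1 : (1 : ℝ) ≤ m := by exact_mod_cast (by omega : 1 ≤ m)
  have hlog : Real.log n ≤ 8 * (m : ℝ) ^ 8 * Real.log m := by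
    have h' : (n : ℝ) ≤ (m : ℝ) ^ (8 * m ^ 8) := by exact_mod_cast h.le
    have := Real.log_le_log hn0 h'
    rwa [Real.log_pow, Nat.cast_mul, Nat.cast_pow, Nat.cast_ofNat] at this
  have hdiv : Real.log n / Real.log (Real.log n) ≤ 8 * (m : ℝ) ^ 8 := by
    rw [div_le_iff₀ (by linarith)]
    rcases le_total (m : ℝ) (Real.log n) with hle | hle
    · exact hlog.trans (mul_le_mul_of_nonneg_left
        (Real.log_le_log (by linarith) hle) (by positivity))
    · have hm8 : (m : ℝ) ≤ (m : ℝ) ^ 8 := le_self_pow₀ hm1 (by norm_num)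
      nlinarith
  have hpow : 8 * (m : ℝ) ^ 8 ≤ (8 * (m : ℝ)) ^ 8 := by
    rw [mul_pow]
    exact mul_le_mul_of_nonneg_right (by norm_num) (by positivity)
  calc (Real.log n / Real.log (Real.log n)) ^ ((1 : ℝ) / 8)
      ≤ ((8 * (m : ℝ)) ^ 8) ^ ((1 : ℝ) / 8) :=
        Real.rpow_le_rpow (div_nonneg hL0.le (by linarith)) (hdiv.trans hpow) (by norm_num)
    _ = 8 * m := by
        have := Real.pow_rpow_inv_natCast (x := 8 * (m : ℝ)) (n := 8) (by positivity) (by norm_num)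
        simpa using this

theorem stmt_9 :
    (∃ c : ℝ, 0 < c ∧ ∃ n₀ : ℕ, ∀ n : ℕ, n₀ ≤ n →
      c * (Real.log (n : ℝ) / Real.log (Real.log (n : ℝ))) ^ ((1 : ℝ) / 8)
        ≤ (localC n SP3 : ℝ)) ∧
    (∀ k : ℕ, 0 < k → ∀ n : ℕ, 2 * k ^ ((k ^ 4 + 1) ^ 2) + k ^ 4 + 3 ≤ n →
      (∀ f : ℕ → Finset ℕ → Fin k, ¬ IsLocalColoring n k SP3 f) ∧ k < localC n SP3) := by
  have hlt : ∀ k n : ℕ, 2 * k ^ ((k ^ 4 + 1) ^ 2) + k ^ 4 + 3 ≤ n → k < localC n SP3 :=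
    fun k n hn => lt_localC (by simp [SP3]) SP3_isUniform (not_isLocalColoring_SP3 hn)
  refine ⟨⟨1 / 8, by norm_num, ⌈Real.exp (Real.exp 1)⌉₊ + 6, fun n hn => ?_⟩,
    fun k _ n hn => ⟨not_isLocalColoring_SP3 hn, hlt k n hn⟩⟩
  have hm : 2 ≤ localC n SP3 := hlt 1 n (by norm_num; omega)
  have hn' : n < localC n SP3 ^ (8 * localC n SP3 ^ 8) := by
    by_contra! hle
    exact lt_irrefl _ (hlt _ n ((two_mul_pow_add_le_pow hm).trans hle))
  have := log_div_log_log_rpow_le (Nat.ceil_le.1 (by omega)) hm hn'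
  linarith
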